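/- arXiv:1212.6280 — 3 statements merged into one kernel-verified Lean document; each statement's English description precedes it below -/
import Mathlib

section
/- (LLN limit of inverse radial moments) Let a > 0 and let p be a probability density on ℝ^d (d > a... assume d ≥ 1 and the bound a/N < d for large N) bounded by a constant C with finite second moment m = ∫ |y|² p(y) dy > 0 and finite fourth moment. Then lim_{N→∞} ∫_{ℝ^{Nd}} (√N / |W|)^a ∏_{j=1}^N p(w_j) dW = m^{−a/2}. -/
open Real MeasureTheory Filter

/-- If nonnegative functions on a probability space converge almost everywhere to a constant and
their second moments are eventually bounded, then their integrals converge. -/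
theorem tendsto_integral_of_ae_tendsto_of_sq_le {Ω : Type*} [MeasurableSpace Ω] (ν : Measure Ω)
    [IsProbabilityMeasure ν] (f : ℕ → Ω → ℝ) (hf : ∀ n, Measurable (f n))
    (hnn : ∀ n ω, 0 ≤ f n ω) (c K : ℝ)
    (hlim : ∀ᵐ ω ∂ν, Tendsto (fun n => f n ω) atTop (nhds c))
    (hint : ∀ᶠ n in atTop, Integrable (fun ω => f n ω ^ 2) ν)
    (hK : ∀ᶠ n in atTop, ∫ ω, f n ω ^ 2 ∂ν ≤ K) :
    Tendsto (fun n => ∫ ω, f n ω ∂ν) atTop (nhds c) := by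
  have htrunc : ∀ M : ℝ, 0 < M → c ≤ M →
      Tendsto (fun n => ∫ ω, min (f n ω) M ∂ν) atTop (nhds c) := by
    intro M hM hcM
    have h := tendsto_integral_of_dominated_convergence (μ := ν)
      (F := fun n ω => min (f n ω) M) (f := fun _ => c) (fun _ => M)
      (fun n => ((hf n).min measurable_const).aestronglyMeasurable) (integrable_const M)
      (fun n => Eventually.of_forall fun ω => by
        rw [norm_eq_abs, abs_of_nonneg (le_min (hnn n ω) hM.le)]
        exact min_le_right _ _)
      (hlim.mono fun ω hω => by
        simpa [min_eq_left hcM] using hω.min (tendsto_const_nhds (x := M)))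
    simpa using h
  rw [Metric.tendsto_atTop']
  intro ε hε
  obtain ⟨M, hM, hcM, hKM⟩ : ∃ M : ℝ, 0 < M ∧ c ≤ M ∧ K / M < ε / 2 := by
    refine ⟨max 1 (max c (2 * (|K| + 1) / ε)), by positivity, by simp, ?_⟩
    have h1 : 2 * (|K| + 1) / ε ≤ max 1 (max c (2 * (|K| + 1) / ε)) := by simp
    have hpos : 0 < max 1 (max c (2 * (|K| + 1) / ε)) := by positivity
    rw [div_le_iff₀ hε] at h1
    rw [div_lt_iff₀ hpos]
    nlinarith [le_abs_self K]
  have h1 := (Metric.tendsto_nhds.1 (htrunc M hM hcM)) (ε / 2) (by positivity)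
  obtain ⟨n₀, hn₀⟩ := eventually_atTop.1 (h1.and (hint.and hK))
  refine ⟨n₀, fun n hn => ?_⟩
  obtain ⟨hd, hi, hk⟩ := hn₀ n hn.le
  have hfi : Integrable (f n) ν :=
    ((memLp_two_iff_integrable_sq (hf n).aestronglyMeasurable).2 hi).integrable (by norm_num)
  have hmi : Integrable (fun ω => min (f n ω) M) ν := hfi.inf (integrable_const M)
  have hle : ∫ ω, min (f n ω) M ∂ν ≤ ∫ ω, f n ω ∂ν :=
    integral_mono hmi hfi fun ω => min_le_left _ _
  have hge : ∫ ω, f n ω ∂ν ≤ ∫ ω, min (f n ω) M ∂ν + K / M := by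
    calc ∫ ω, f n ω ∂ν ≤ ∫ ω, (min (f n ω) M + f n ω ^ 2 / M) ∂ν := by
          refine integral_mono hfi (hmi.add (hi.div_const M)) fun ω => ?_
          rcases le_total (f n ω) M with h | h
          · simp only [min_eq_left h]
            have : 0 ≤ f n ω ^ 2 / M := by positivity
            linarith
          · simp only [min_eq_right h]
            have : f n ω ≤ f n ω ^ 2 / M := by
              rw [le_div_iff₀ hM]
              nlinarith [hnn n ω]
            linarith
      _ = ∫ ω, min (f n ω) M ∂ν + (∫ ω, f n ω ^ 2 ∂ν) / M := by
          rw [integral_add hmi (hi.div_const M), integral_div]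
      _ ≤ _ := by gcongr
  rw [Real.dist_eq, abs_lt] at hd ⊢
  constructor <;> linarith [hd.1, hd.2]

/-- AM-GM bound for inverse powers of the normalized radius. -/
theorem sq_radial_le_prod {E : Type*} [NormedAddCommGroup E] {N : ℕ} (hN : 0 < N) (a : ℝ)
    (ha : 0 < a) (W : Fin N → E) (hW : ∀ j, W j ≠ 0) :
    ((√N / √(∑ j, ‖W j‖ ^ 2)) ^ a) ^ 2 ≤ ∏ j, ‖W j‖ ^ (-(2 * a / N)) := by
  have hN' : (0 : ℝ) < N := by exact_mod_cast hN
  have hpos : ∀ j, 0 < ‖W j‖ := fun j => norm_pos_iff.2 (hW j)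
  have hgm := Real.geom_mean_le_arith_mean_weighted Finset.univ (fun _ : Fin N => (N : ℝ)⁻¹)
    (fun j => ‖W j‖ ^ 2) (fun _ _ => by positivity) (by simp [hN'.ne']) (fun _ _ => by positivity)
  rw [← Finset.mul_sum] at hgm
  have hG : 0 < ∏ j, (‖W j‖ ^ 2) ^ (N : ℝ)⁻¹ :=
    Finset.prod_pos fun j _ => Real.rpow_pos_of_pos (pow_pos (hpos j) 2) _
  have hx : 0 < (N : ℝ)⁻¹ * ∑ j, ‖W j‖ ^ 2 := hG.trans_le hgm
  have hL : ((√N / √(∑ j, ‖W j‖ ^ 2)) ^ a) ^ 2 = ((N : ℝ)⁻¹ * ∑ j, ‖W j‖ ^ 2) ^ (-a) := by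
    rw [← Real.sqrt_div hN'.le, Real.sqrt_eq_rpow, ← Real.rpow_natCast, ← Real.rpow_mul,
      ← Real.rpow_mul, Real.rpow_neg hx.le, ← Real.inv_rpow hx.le]
    · congr 1
      · rw [mul_inv, inv_inv, div_eq_mul_inv]
      · push_cast; ring
    · positivity
    · positivity
  have hR : ∏ j, ‖W j‖ ^ (-(2 * a / N)) = (∏ j, (‖W j‖ ^ 2) ^ (N : ℝ)⁻¹) ^ (-a) := by
    rw [← Real.finsetProd_rpow _ _ fun j _ => by positivity]
    refine Finset.prod_congr rfl fun j _ => ?_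
    rw [← Real.rpow_natCast, ← Real.rpow_mul (norm_nonneg _), ← Real.rpow_mul (norm_nonneg _)]
    congr 1
    push_cast
    field_simp
  rw [hL, hR]
  exact Real.rpow_le_rpow_of_nonpos hG hgm (by linarith)

/-- Uniform second-moment bound for inverse powers of the normalized radius of an i.i.d. sample. -/
theorem integral_sq_radial_le {E : Type*} [NormedAddCommGroup E] [MeasurableSpace E]
    [BorelSpace E] (μ : Measure E) [IsProbabilityMeasure μ] (h0 : ∀ᵐ y ∂μ, y ≠ 0)
    (a s : ℝ) (ha : 0 < a) (hs : 0 < s) (hint : Integrable (fun y => ‖y‖ ^ (-s)) μ)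
    {N : ℕ} (hN : 0 < N) (hNs : 2 * a / s ≤ N) :
    Integrable (fun W : Fin N → E => ((√N / √(∑ j, ‖W j‖ ^ 2)) ^ a) ^ 2)
        (Measure.pi fun _ => μ) ∧
      ∫ W : Fin N → E, ((√N / √(∑ j, ‖W j‖ ^ 2)) ^ a) ^ 2 ∂(Measure.pi fun _ => μ) ≤
        exp (2 * a / s * ((∫ y, ‖y‖ ^ (-s) ∂μ) - 1)) := by
  have hN' : (0 : ℝ) < N := by exact_mod_cast hN
  set H := ∫ y, ‖y‖ ^ (-s) ∂μ with hH
  set θ : ℝ := 2 * a / s / N with hθ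
  have hθ0 : 0 ≤ θ := by positivity
  have hθ1 : θ ≤ 1 := (div_le_one hN').2 hNs
  have hbd : ∀ y : E, ‖y‖ ^ (-(2 * a / N)) ≤ 1 + θ * (‖y‖ ^ (-s) - 1) := by
    intro y
    have hp : 0 ≤ ‖y‖ ^ (-s) := by positivity
    have h := rpow_one_add_le_one_add_mul_self (s := ‖y‖ ^ (-s) - 1) (by linarith) hθ0 hθ1
    rw [add_sub_cancel, ← Real.rpow_mul (norm_nonneg _)] at h
    convert h using 2
    rw [hθ]
    field_simp
  have hsi : Integrable (fun y : E => θ * (‖y‖ ^ (-s) - 1)) μ :=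
    (hint.sub (integrable_const 1)).const_mul θ
  have hbi : Integrable (fun y : E => 1 + θ * (‖y‖ ^ (-s) - 1)) μ :=
    (integrable_const 1).add hsi
  have hmn : Measurable fun y : E => ‖y‖ ^ (-(2 * a / N)) := measurable_norm.pow_const _
  have hgi : Integrable (fun y : E => ‖y‖ ^ (-(2 * a / N))) μ :=
    hbi.mono' hmn.aestronglyMeasurable (Eventually.of_forall fun y => by
      rw [norm_eq_abs, abs_of_nonneg (by positivity)]; exact hbd y)
  have hgle : ∫ y, ‖y‖ ^ (-(2 * a / N)) ∂μ ≤ exp (θ * (H - 1)) := by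
    calc ∫ y, ‖y‖ ^ (-(2 * a / N)) ∂μ ≤ ∫ y, (1 + θ * (‖y‖ ^ (-s) - 1)) ∂μ :=
          integral_mono hgi hbi hbd
      _ = 1 + θ * (H - 1) := by
          rw [integral_add (integrable_const 1) hsi, integral_const_mul, integral_sub hint (integrable_const 1)]
          simp [hH]
      _ ≤ _ := by linarith [Real.add_one_le_exp (θ * (H - 1))]
  have hprod : Integrable (fun W : Fin N → E => ∏ j, ‖W j‖ ^ (-(2 * a / N)))
      (Measure.pi fun _ => μ) := Integrable.fintype_prod fun _ => hgi
  have hW0 : ∀ᵐ W : Fin N → E ∂(Measure.pi fun _ => μ), ∀ j, W j ≠ 0 :=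
    ae_all_iff.2 fun j =>
      (measurePreserving_eval (fun _ : Fin N => μ) j).quasiMeasurePreserving.ae h0
  have hle : (fun W : Fin N → E => ((√N / √(∑ j, ‖W j‖ ^ 2)) ^ a) ^ 2)
      ≤ᵐ[Measure.pi fun _ => μ] fun W => ∏ j, ‖W j‖ ^ (-(2 * a / N)) :=
    hW0.mono fun W hW => sq_radial_le_prod hN a ha W hW
  have hmeas : Measurable fun W : Fin N → E => ((√N / √(∑ j, ‖W j‖ ^ 2)) ^ a) ^ 2 := by
    have hsum : Measurable fun W : Fin N → E => ∑ j, ‖W j‖ ^ 2 :=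
      Finset.measurable_fun_sum _ fun j _ =>
        (measurable_norm.comp (measurable_pi_apply j)).pow_const 2
    fun_prop
  have hI : Integrable (fun W : Fin N → E => ((√N / √(∑ j, ‖W j‖ ^ 2)) ^ a) ^ 2)
      (Measure.pi fun _ => μ) :=
    hprod.mono' hmeas.aestronglyMeasurable (hle.mono fun W hW => by
      rw [norm_eq_abs, abs_of_nonneg (by positivity)]; exact hW)
  refine ⟨hI, (integral_mono_ae hI hprod hle).trans ?_⟩
  rw [integral_fintype_prod_eq_pow (fun y : E => ‖y‖ ^ (-(2 * a / N))), Fintype.card_fin]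
  calc (∫ y, ‖y‖ ^ (-(2 * a / N)) ∂μ) ^ N ≤ exp (θ * (H - 1)) ^ N :=
        pow_le_pow_left₀ (integral_nonneg fun y => by positivity) hgle N
    _ = _ := by
        rw [← Real.exp_nat_mul, hθ]
        congr 1
        field_simp

/-- Law of large numbers for inverse moments of the normalized radius of an i.i.d. sample. -/
theorem tendsto_integral_radial {E : Type*} [NormedAddCommGroup E] [MeasurableSpace E]
    [BorelSpace E] (μ : Measure E) [IsProbabilityMeasure μ] (h0 : ∀ᵐ y ∂μ, y ≠ 0)
    (a s m : ℝ) (ha : 0 < a) (hs : 0 < s) (hint : Integrable (fun y => ‖y‖ ^ (-s)) μ)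
    (h2 : Integrable (fun y => ‖y‖ ^ 2) μ) (hm : m = ∫ y, ‖y‖ ^ 2 ∂μ) (hm0 : 0 < m) :
    Tendsto (fun N : ℕ => ∫ W : Fin N → E, (√N / √(∑ j, ‖W j‖ ^ 2)) ^ a
      ∂(Measure.pi fun _ => μ)) atTop (nhds (m ^ (-a / 2))) := by
  have hsq : Measurable fun y : E => ‖y‖ ^ 2 := measurable_norm.pow_const 2
  set ν : Measure (ℕ → E) := Measure.infinitePi fun _ => μ with hν
  have hmap : ∀ N : ℕ, MeasurePreserving (fun (ω : ℕ → E) (i : Fin N) => ω i) ν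
      (Measure.pi fun _ => μ) := fun N =>
    ⟨by fun_prop, by
      rw [hν, Measure.map_infinitePi_infinitePi_of_inj (P := fun _ : ℕ => μ)
        (f := fun i : Fin N => (i : ℕ)) Fin.val_injective, Measure.infinitePi_eq_pi]⟩
  have hFm : ∀ N : ℕ, Measurable fun W : Fin N → E => (√N / √(∑ j, ‖W j‖ ^ 2)) ^ a := by
    intro N
    have hsum : Measurable fun W : Fin N → E => ∑ j, ‖W j‖ ^ 2 :=
      Finset.measurable_fun_sum _ fun j _ => hsq.comp (measurable_pi_apply j)
    fun_prop
  have hev : ∀ j : ℕ, MeasurePreserving (fun ω : ℕ → E => ω j) ν μ := fun j =>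
    measurePreserving_eval_infinitePi (fun _ => μ) j
  have hind : ProbabilityTheory.iIndepFun (fun (j : ℕ) (ω : ℕ → E) => ‖ω j‖ ^ 2) ν :=
    ProbabilityTheory.iIndepFun_infinitePi (X := fun _ y => ‖y‖ ^ 2) fun _ => hsq
  have hslln := ProbabilityTheory.strong_law_ae_real (μ := ν)
    (fun (j : ℕ) (ω : ℕ → E) => ‖ω j‖ ^ 2) ((hev 0).integrable_comp_of_integrable h2)
    (fun i j hij => hind.indepFun hij)
    (fun j => ⟨(hsq.comp (hev j).measurable).aemeasurable,
      (hsq.comp (hev 0).measurable).aemeasurable, by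
        change Measure.map ((fun y : E => ‖y‖ ^ 2) ∘ fun ω : ℕ → E => ω j) ν =
          Measure.map ((fun y : E => ‖y‖ ^ 2) ∘ fun ω : ℕ → E => ω 0) ν
        rw [← Measure.map_map hsq (hev j).measurable, ← Measure.map_map hsq (hev 0).measurable,
          (hev j).map_eq, (hev 0).map_eq]⟩)
  have hmean : ∫ ω, ‖ω 0‖ ^ 2 ∂ν = m := by
    rw [hm, ← (hev 0).map_eq, integral_map (hev 0).measurable.aemeasurable
      hsq.aestronglyMeasurable]
  rw [hmean] at hslln
  have htr : ∀ (N : ℕ) (G : (Fin N → E) → ℝ), Measurable G →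
      ∫ ω, G (fun i : Fin N => ω i) ∂ν = ∫ W, G W ∂(Measure.pi fun _ => μ) := by
    intro N G hG
    rw [← (hmap N).map_eq, integral_map (hmap N).measurable.aemeasurable
      hG.aestronglyMeasurable]
  simp_rw [← fun N => htr N _ (hFm N)]
  have hlarge : ∀ᶠ N : ℕ in atTop, 0 < N ∧ 2 * a / s ≤ N :=
    (eventually_gt_atTop 0).and (tendsto_natCast_atTop_atTop.eventually_ge_atTop _)
  refine tendsto_integral_of_ae_tendsto_of_sq_le ν
    (fun N ω => (√N / √(∑ j : Fin N, ‖ω j‖ ^ 2)) ^ a) (fun N => (hFm N).comp (hmap N).measurable) (fun N ω => by positivity) _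
    (exp (2 * a / s * ((∫ y, ‖y‖ ^ (-s) ∂μ) - 1))) ?_ ?_ ?_
  · filter_upwards [hslln] with ω hω
    have hval : m ^ (-a / 2) = (√(m⁻¹)) ^ a := by
      rw [Real.sqrt_eq_rpow, ← Real.rpow_mul (by positivity), Real.inv_rpow hm0.le,
        ← Real.rpow_neg hm0.le]
      congr 1
      ring
    rw [hval]
    refine (((hω.inv₀ hm0.ne').sqrt).rpow_const (Or.inr ha.le)).congr fun N => ?_
    rw [inv_div, Real.sqrt_div (Nat.cast_nonneg N),
      Finset.sum_range fun j => ‖ω j‖ ^ 2]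
  · filter_upwards [hlarge] with N hN
    exact (hmap N).integrable_comp_of_integrable
      (integral_sq_radial_le μ h0 a s ha hs hint hN.1 hN.2).1
  · filter_upwards [hlarge] with N hN
    exact (htr N _ ((hFm N).pow_const 2)).trans_le
      (integral_sq_radial_le μ h0 a s ha hs hint hN.1 hN.2).2

/-- A finite power of an integrable density is the density of the product measure. -/
theorem pi_withDensity_ofReal {E ι : Type*} [Fintype ι] [MeasureSpace E]
    [SigmaFinite (volume : Measure E)] (p : E → ℝ) (hnn : ∀ y, 0 ≤ p y)
    (hint : Integrable p) :
    Measure.pi (fun _ : ι => (volume : Measure E).withDensity fun y => ENNReal.ofReal (p y)) =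
      (volume : Measure (ι → E)).withDensity fun W => ENNReal.ofReal (∏ j, p (W j)) := by
  refine Measure.pi_eq fun t ht => ?_
  rw [withDensity_apply _ (MeasurableSet.univ_pi ht), volume_pi, Measure.restrict_pi_pi,
    ← ofReal_integral_eq_lintegral_ofReal
      (Integrable.fintype_prod fun i => hint.restrict (s := t i))
      (Eventually.of_forall fun W => Finset.prod_nonneg fun j _ => hnn _),
    integral_fintype_prod_eq_prod (fun _ : ι => p),
    ENNReal.ofReal_prod_of_nonneg fun j _ => integral_nonneg hnn]
  refine Finset.prod_congr rfl fun i _ => ?_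
  rw [withDensity_apply _ (ht i), ← ofReal_integral_eq_lintegral_ofReal hint.restrict
    (Eventually.of_forall hnn)]

/-- A bounded integrable density has a finite inverse moment of order `1 / 2`. -/
theorem integrable_inv_sqrt_norm_mul {E : Type*} [NormedAddCommGroup E] [NormedSpace ℝ E]
    [FiniteDimensional ℝ E] [MeasurableSpace E] [BorelSpace E] (μ : Measure E)
    [μ.IsAddHaarMeasure] (hd : 1 ≤ Module.finrank ℝ E) (p : E → ℝ) (hp : Measurable p) (C : ℝ)
    (hnn : ∀ y, 0 ≤ p y) (hC : ∀ y, p y ≤ C) (hint : Integrable p μ) :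
    Integrable (fun y => ‖y‖ ^ (-(1 / 2 : ℝ)) * p y) μ := by
  have hmeas : Measurable fun y : E => ‖y‖ ^ (-(1 / 2 : ℝ)) * p y :=
    (measurable_norm.pow_const _).mul hp
  have hball : IntegrableOn (fun y => ‖y‖ ^ (-(1 / 2 : ℝ)) * p y) (Metric.ball 0 1) μ := by
    refine integrableOn_ball_of_norm_le_rpow hd (C := C) (α := 1 / 2) ?_
      (Eventually.of_forall fun y => ?_) hmeas.aestronglyMeasurable
    · have : (1 : ℝ) ≤ Module.finrank ℝ E := by exact_mod_cast hd
      linarith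
    · rw [norm_eq_abs, abs_of_nonneg (mul_nonneg (by positivity) (hnn y)), mul_comm]
      gcongr
      exact hC y
  have hcompl : IntegrableOn (fun y => ‖y‖ ^ (-(1 / 2 : ℝ)) * p y) (Metric.ball 0 1)ᶜ μ := by
    refine Integrable.mono' hint.integrableOn hmeas.aestronglyMeasurable ?_
    filter_upwards [ae_restrict_mem Metric.isOpen_ball.measurableSet.compl] with y hy
    have hy1 : 1 ≤ ‖y‖ := by simpa using hy
    rw [norm_eq_abs, abs_of_nonneg (mul_nonneg (by positivity) (hnn y))]
    exact mul_le_of_le_one_left (hnn y) (Real.rpow_le_one_of_one_le_of_nonpos hy1 (by norm_num))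
  rw [← integrableOn_univ, ← Set.union_compl_self (Metric.ball (0 : E) 1)]
  exact hball.union hcompl

/-- LLN limit of inverse radial moments:
`lim_{N→∞} ∫ (√N/|W|)^a ∏_j p(w_j) dW = m^{-a/2}`. -/
theorem lln_inverse_radial_moment (d : ℕ) (hd : 1 ≤ d) (a C : ℝ) (ha : 0 < a)
    (p : EuclideanSpace ℝ (Fin d) → ℝ) (hmeas : Measurable p)
    (hnn : ∀ y, 0 ≤ p y) (hC : ∀ y, p y ≤ C) (hnorm : ∫ y, p y = 1)
    (m : ℝ) (h2 : Integrable fun y : EuclideanSpace ℝ (Fin d) => ‖y‖ ^ 2 * p y)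
    (hm : m = ∫ y : EuclideanSpace ℝ (Fin d), ‖y‖ ^ 2 * p y) (hm0 : 0 < m)
    (h4 : Integrable fun y : EuclideanSpace ℝ (Fin d) => (‖y‖ ^ 2 - m) ^ 2 * p y) :
    Tendsto (fun N : ℕ =>
        ∫ W : Fin N → EuclideanSpace ℝ (Fin d),
          (Real.sqrt N / Real.sqrt (∑ j, ‖W j‖ ^ 2)) ^ a * ∏ j, p (W j))
      atTop (nhds (m ^ (-a / 2))) := by
  have hpi : Integrable p := by
    by_contra h
    rw [integral_undef h] at hnorm
    exact zero_ne_one hnorm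
  have hfin : Module.finrank ℝ (EuclideanSpace ℝ (Fin d)) = d := by simp
  have : Nontrivial (EuclideanSpace ℝ (Fin d)) :=
    Module.nontrivial_of_finrank_pos (R := ℝ) (by omega)
  have hpE : Measurable fun y => ENNReal.ofReal (p y) := hmeas.ennreal_ofReal
  set μ : Measure (EuclideanSpace ℝ (Fin d)) :=
    volume.withDensity fun y => ENNReal.ofReal (p y) with hμ
  have hprob : IsProbabilityMeasure μ := ⟨by
    rw [hμ, withDensity_apply _ MeasurableSet.univ, Measure.restrict_univ,
      ← ofReal_integral_eq_lintegral_ofReal hpi (Eventually.of_forall hnn), hnorm,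
      ENNReal.ofReal_one]⟩
  have hiff : ∀ g : EuclideanSpace ℝ (Fin d) → ℝ,
      Integrable g μ ↔ Integrable fun y => g y * p y := by
    intro g
    rw [hμ, integrable_withDensity_iff hpE (Eventually.of_forall fun _ => ENNReal.ofReal_lt_top)]
    simp only [ENNReal.toReal_ofReal (hnn _)]
  have h0 : ∀ᵐ y ∂μ, y ≠ 0 :=
    (withDensity_absolutelyContinuous _ _).ae_le (Measure.ae_ne volume 0)
  have hm' : m = ∫ y, ‖y‖ ^ 2 ∂μ := by
    rw [hm, hμ, integral_withDensity_eq_integral_toReal_smul hpE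
      (Eventually.of_forall fun _ => ENNReal.ofReal_lt_top)]
    simp only [ENNReal.toReal_ofReal (hnn _), smul_eq_mul, mul_comm]
  refine (tendsto_integral_radial μ h0 a (1 / 2) m ha (by norm_num)
    ((hiff _).2 (integrable_inv_sqrt_norm_mul volume (by omega) p hmeas C hnn hC hpi))
    ((hiff _).2 h2) hm' hm0).congr fun N => ?_
  have hPm : Measurable fun W : Fin N → EuclideanSpace ℝ (Fin d) =>
      ENNReal.ofReal (∏ j, p (W j)) :=
    (Finset.measurable_fun_prod _ fun j _ => hmeas.comp (measurable_pi_apply j)).ennreal_ofReal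
  rw [hμ, pi_withDensity_ofReal p hnn hpi, integral_withDensity_eq_integral_toReal_smul hPm
    (Eventually.of_forall fun _ => ENNReal.ofReal_lt_top)]
  refine integral_congr_ae (Eventually.of_forall fun W => ?_)
  simp only [smul_eq_mul]
  rw [ENNReal.toReal_ofReal (Finset.prod_nonneg fun j _ => hnn _), mul_comm]
end

section
/- lim_{N→∞} ∫_{ℝ^{Nd}} (√N/|W|) ∏_{j=1}^N g(w_j) dW = μ^{−1/2}, where g(w) = e^{−|w|^{2+α}}/c is the normalized density and μ = ∫_{ℝ^d} |w|² g(w) dw. -/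
open Real MeasureTheory Filter

/-- A product of measures with real densities has the product density. -/
theorem MeasureTheory.Measure.pi_withDensity_ofReal {ι E : Type*} [Fintype ι] [MeasurableSpace E]
    (ν : Measure E) [SigmaFinite ν] {g : E → ℝ} (hg : Integrable g ν) (hg0 : ∀ x, 0 ≤ g x) :
    Measure.pi (fun _ : ι => ν.withDensity fun x => ENNReal.ofReal (g x)) =
      (Measure.pi fun _ : ι => ν).withDensity fun x => ENNReal.ofReal (∏ i, g (x i)) := by
  refine Measure.pi_eq fun s hs => ?_
  rw [withDensity_apply _ (MeasurableSet.univ_pi hs), Measure.restrict_pi_pi,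
    ← ofReal_integral_eq_lintegral_ofReal
      (Integrable.fintype_prod_dep (f := fun _ : ι => g) fun i => hg.restrict)
      (ae_of_all _ fun x => Finset.prod_nonneg fun i _ => hg0 _),
    integral_fintype_prod_eq_prod (fun _ : ι => g),
    ENNReal.ofReal_prod_of_nonneg fun i _ => integral_nonneg hg0]
  refine Finset.prod_congr rfl fun i _ => ?_
  rw [withDensity_apply _ (hs i),
    ofReal_integral_eq_lintegral_ofReal hg.restrict (ae_of_all _ hg0)]

theorem abs_inv_sqrt_sub_inv_sqrt_le {x m : ℝ} (hx : 0 < x) (hm : 0 < m) :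
    |(√x)⁻¹ - (√m)⁻¹| ≤ |x - m| * (√x)⁻¹ / m := by
  have hx' := Real.sqrt_pos.2 hx
  have hm' := Real.sqrt_pos.2 hm
  have key : (√x)⁻¹ - (√m)⁻¹ = (m - x) * (√x)⁻¹ / (√m * (√x + √m)) := by
    field_simp
    nlinarith [Real.sq_sqrt hx.le, Real.sq_sqrt hm.le]
  rw [key, abs_div, abs_mul, abs_sub_comm m x, abs_of_pos (inv_pos.2 hx'),
    abs_of_pos (by positivity : 0 < √m * (√x + √m))]
  refine div_le_div_of_nonneg_left (by positivity) hm ?_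
  nlinarith [Real.sq_sqrt hm.le]

/-- The error in replacing `x` by `m` under an inverse square root, after Young's inequality. -/
theorem abs_inv_sqrt_sub_inv_sqrt_le_add {x m t : ℝ} (hx : 0 < x) (hm : 0 < m) (ht : 0 < t) :
    |(√x)⁻¹ - (√m)⁻¹| ≤ (t * (x - m) ^ 2 + t⁻¹ * x⁻¹) / (2 * m) := by
  refine (abs_inv_sqrt_sub_inv_sqrt_le hx hm).trans ?_
  have h1 : (√x)⁻¹ ^ 2 = x⁻¹ := by rw [inv_pow, Real.sq_sqrt hx.le]
  have h2 : 0 ≤ t⁻¹ * (t * |x - m| - (√x)⁻¹) ^ 2 := by positivity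
  have h3 : t⁻¹ * (t * |x - m| - (√x)⁻¹) ^ 2 =
      t * (x - m) ^ 2 + t⁻¹ * x⁻¹ - 2 * (|x - m| * (√x)⁻¹) := by
    rw [← h1, ← sq_abs (x - m)]
    field_simp
    ring
  rw [div_le_div_iff₀ hm (by positivity)]
  nlinarith

/-- AM-GM, in reciprocal form. -/
theorem inv_sum_div_card_le_prod_rpow {N : ℕ} (hN : 0 < N) {y : Fin N → ℝ} (hy : ∀ i, 0 < y i) :
    ((∑ i, y i) / N)⁻¹ ≤ ∏ i, y i ^ (-(N : ℝ)⁻¹) := by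
  have hN' : (0 : ℝ) < N := by exact_mod_cast hN
  have h := Real.geom_mean_le_arith_mean_weighted Finset.univ (fun _ => (N : ℝ)⁻¹) y
    (fun _ _ => by positivity) (by simp [hN'.ne']) (fun i _ => (hy i).le)
  rw [← Finset.mul_sum, mul_comm, ← div_eq_mul_inv] at h
  refine (inv_anti₀ (Finset.prod_pos fun i _ => rpow_pos_of_pos (hy i) _) h).trans_eq ?_
  rw [← Finset.prod_inv_distrib]
  exact Finset.prod_congr rfl fun i _ => (rpow_neg (hy i).le _).symm

section

variable {E : Type*} [MeasurableSpace E] {ν : Measure E} [IsProbabilityMeasure ν] {f : E → ℝ}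

theorem integrable_rpow_neg_of_le (hf : Measurable f) (hpos : ∀ᵐ x ∂ν, 0 < f x) {p q : ℝ}
    (hp : 0 ≤ p) (hpq : p ≤ q) (hi : Integrable (fun x => f x ^ (-q)) ν) :
    Integrable (fun x => f x ^ (-p)) ν := by
  refine (hi.add (integrable_const 1)).mono' (hf.pow_const _).aestronglyMeasurable ?_
  filter_upwards [hpos] with x hx
  rw [Real.norm_of_nonneg (rpow_nonneg hx.le _)]
  simp only [Pi.add_apply]
  rcases le_total 1 (f x) with h | h
  · exact (rpow_le_one_of_one_le_of_nonpos h (by linarith)).trans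
      (le_add_of_nonneg_left (rpow_nonneg hx.le _))
  · exact (rpow_le_rpow_of_exponent_ge hx h (by linarith)).trans (le_add_of_nonneg_right one_pos.le)

/-- Jensen's inequality for negative moments. -/
theorem integral_rpow_neg_rpow_le (hf : Measurable f) (hpos : ∀ᵐ x ∂ν, 0 < f x) {p q : ℝ}
    (hp : 0 < p) (hpq : p ≤ q) (hi : Integrable (fun x => f x ^ (-q)) ν) :
    (∫ x, f x ^ (-p) ∂ν) ^ (q / p) ≤ ∫ x, f x ^ (-q) ∂ν := by
  have hae : (fun x => (f x ^ (-p)) ^ (q / p)) =ᵐ[ν] fun x => f x ^ (-q) := by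
    filter_upwards [hpos] with x hx
    rw [← rpow_mul hx.le]
    congr 1
    field_simp
  have h1 : 1 ≤ q / p := (one_le_div hp).2 hpq
  rw [← integral_congr_ae hae]
  refine (convexOn_rpow h1).map_integral_le
    (continuousOn_id.rpow_const fun _ _ => Or.inr (by linarith)) isClosed_Ici ?_
    (integrable_rpow_neg_of_le hf hpos hp.le hpq hi) (hi.congr hae.symm)
  filter_upwards [hpos] with x hx using rpow_nonneg hx.le _

/-- Convergence of the expected inverse square root of the empirical mean, for an a.e. positive
square integrable function with a finite negative moment. -/
theorem tendsto_integral_sqrt_div_sqrt_sum (hf : Measurable f) (hpos : ∀ᵐ x ∂ν, 0 < f x)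
    (hf2 : MemLp f 2 ν) {k : ℕ} (hk : 0 < k)
    (hi : Integrable (fun x => f x ^ (-(k : ℝ)⁻¹)) ν) :
    Tendsto (fun N : ℕ => ∫ W : Fin N → E, √N / √(∑ j, f (W j)) ∂(Measure.pi fun _ => ν))
      atTop (nhds (1 / √(∫ x, f x ∂ν))) := by
  set m := ∫ x, f x ∂ν with hm_def
  set V := ProbabilityTheory.variance f ν
  set K := ∫ x, f x ^ (-(k : ℝ)⁻¹) ∂ν
  have hfi : Integrable f ν := hf2.integrable one_le_two
  have hm : 0 < m := by
    refine (integral_pos_iff_support_of_nonneg_ae (hpos.mono fun x hx => hx.le) hfi).2 ?_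
    have : ν (Function.support f) = 1 :=
      (mem_ae_iff_prob_eq_one (measurableSet_support hf)).1 (hpos.mono fun x hx => hx.ne')
    simp [this]
  rw [tendsto_iff_dist_tendsto_zero]
  have hlim : Tendsto (fun N : ℕ => (√(N : ℝ))⁻¹ * ((V + K ^ k) / (2 * m))) atTop (nhds 0) := by
    rw [← zero_mul ((V + K ^ k) / (2 * m))]
    exact ((tendsto_inv_atTop_zero.comp Real.tendsto_sqrt_atTop).comp
      tendsto_natCast_atTop_atTop).mul_const _
  refine squeeze_zero' (Eventually.of_forall fun _ => dist_nonneg) ?_ hlim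
  filter_upwards [eventually_ge_atTop k] with N hN
  have hN0 : 0 < N := hk.trans_le hN
  have hNR : (0 : ℝ) < N := by exact_mod_cast hN0
  have hkR : (0 : ℝ) < k := by exact_mod_cast hk
  have hinv : (N : ℝ)⁻¹ ≤ (k : ℝ)⁻¹ := inv_anti₀ hkR (by exact_mod_cast hN)
  have hs : 0 < √(N : ℝ) := Real.sqrt_pos.2 hNR
  set P : Measure (Fin N → E) := Measure.pi fun _ => ν
  set S : (Fin N → E) → ℝ := ∑ i, fun W => f (W i) with hS_def
  have hS : ∀ W, ∑ j, f (W j) = S W := fun W => by simp [hS_def]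
  have hSm : Measurable S := by
    rw [hS_def, Finset.sum_fn]
    exact Finset.measurable_sum _ fun i _ => hf.comp (measurable_pi_apply i)
  have hposP : ∀ᵐ W ∂P, ∀ i, 0 < f (W i) :=
    eventually_all.2 fun i => (measurePreserving_eval (fun _ => ν) i).quasiMeasurePreserving.ae hpos
  have hS2 : MemLp S 2 P :=
    memLp_finsetSum' _ fun i _ => hf2.comp_measurePreserving (measurePreserving_eval _ i)
  have hSmean : ∫ W, S W ∂P = N * m := by
    simp only [← hS]
    rw [integral_finsetSum _ fun i _ => integrable_comp_eval (μ := fun _ : Fin N => ν) hfi]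
    simp [integral_comp_eval (μ := fun _ : Fin N => ν) hf.aestronglyMeasurable, hm_def]
  have hvar : ∫ W, (S W / N - m) ^ 2 ∂P = V / N := by
    have h1 : ∫ W, (S W - N * m) ^ 2 ∂P = N * V := by
      rw [← hSmean, ← ProbabilityTheory.variance_eq_integral hSm.aemeasurable,
        ProbabilityTheory.variance_sum_pi fun _ => hf2]
      simp [V]
    have h2 : ∀ W, (S W / N - m) ^ 2 = (S W - N * m) ^ 2 / (N : ℝ) ^ 2 := fun W => by
      field_simp
    simp only [h2]
    rw [integral_div, h1]
    field_simp
  have hvari : Integrable (fun W => (S W / N - m) ^ 2) P :=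
    ((hS2.mul_const (N : ℝ)⁻¹).sub (memLp_const m)).integrable_sq
  have hY : Integrable (fun x => f x ^ (-(N : ℝ)⁻¹)) ν :=
    integrable_rpow_neg_of_le hf hpos (by positivity) hinv hi
  have hprodi : Integrable (fun W : Fin N → E => ∏ i, f (W i) ^ (-(N : ℝ)⁻¹)) P :=
    Integrable.fintype_prod (f := fun _ x => f x ^ (-(N : ℝ)⁻¹)) fun _ => hY
  have hprod : ∫ W : Fin N → E, ∏ i, f (W i) ^ (-(N : ℝ)⁻¹) ∂P ≤ K ^ k := by
    have hY0 : 0 ≤ ∫ x, f x ^ (-(N : ℝ)⁻¹) ∂ν :=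
      integral_nonneg_of_ae (hpos.mono fun x hx => rpow_nonneg hx.le _)
    rw [integral_fintype_prod_eq_pow (fun x => f x ^ (-(N : ℝ)⁻¹)), Fintype.card_fin]
    have hJ := integral_rpow_neg_rpow_le hf hpos (inv_pos.2 hNR) hinv hi
    calc (∫ x, f x ^ (-(N : ℝ)⁻¹) ∂ν) ^ N
        = ((∫ x, f x ^ (-(N : ℝ)⁻¹) ∂ν) ^ ((k : ℝ)⁻¹ / (N : ℝ)⁻¹)) ^ k := by
          rw [← rpow_natCast, ← rpow_natCast, ← rpow_mul hY0]
          congr 1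
          field_simp
      _ ≤ K ^ k := pow_le_pow_left₀ (rpow_nonneg hY0 _) hJ k
  set G : (Fin N → E) → ℝ := fun W =>
    (√(N : ℝ) * (S W / N - m) ^ 2 + (√(N : ℝ))⁻¹ * ∏ i, f (W i) ^ (-(N : ℝ)⁻¹)) / (2 * m)
  have hGi : Integrable G P := ((hvari.const_mul _).add (hprodi.const_mul _)).div_const _
  have hbound : ∀ᵐ W ∂P, ‖√(N : ℝ) / √(S W) - 1 / √m‖ ≤ G W := by
    filter_upwards [hposP] with W hW
    have : Nonempty (Fin N) := ⟨⟨0, hN0⟩⟩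
    have hSpos : 0 < S W / N := by
      rw [← hS]
      exact div_pos (Finset.sum_pos (fun i _ => hW i) Finset.univ_nonempty) hNR
    have h1 : √(N : ℝ) / √(S W) = (√(S W / N))⁻¹ := by
      rw [Real.sqrt_div' _ hNR.le, inv_div]
    rw [h1, one_div, Real.norm_eq_abs]
    refine (abs_inv_sqrt_sub_inv_sqrt_le_add hSpos hm hs).trans ?_
    have := inv_sum_div_card_le_prod_rpow hN0 hW
    rw [hS] at this
    simp only [G]
    gcongr
  have hFm : Measurable fun W => √(N : ℝ) / √(S W) - 1 / √m :=
    (hSm.sqrt.const_div _).sub_const _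
  have hFi : Integrable (fun W => √(N : ℝ) / √(S W) - 1 / √m) P :=
    hGi.mono' hFm.aestronglyMeasurable hbound
  have hXi : Integrable (fun W => √(N : ℝ) / √(S W)) P := by
    exact (hFi.add (integrable_const (1 / √m))).congr (ae_of_all _ fun W => sub_add_cancel _ _)
  have hsub : ∫ W, √(N : ℝ) / √(S W) ∂P - 1 / √m = ∫ W, (√(N : ℝ) / √(S W) - 1 / √m) ∂P := by
    rw [integral_sub hXi (integrable_const _)]
    simp
  simp only [hS]
  rw [Real.dist_eq, hsub, ← Real.norm_eq_abs]
  refine (norm_integral_le_of_norm_le hGi hbound).trans ?_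
  rw [integral_div, integral_add (hvari.const_mul _) (hprodi.const_mul _), integral_const_mul,
    integral_const_mul, hvar]
  have h3 : √(N : ℝ) * (V / N) = (√(N : ℝ))⁻¹ * V := by
    field_simp
    rw [Real.sq_sqrt hNR.le, mul_comm]
  rw [h3, ← mul_add, mul_div_assoc]
  gcongr

end

/-- `‖w‖ ^ s * exp (-‖w‖ ^ p)` is integrable for `s > -1`. -/
theorem integrable_norm_rpow_mul_exp_neg_norm_rpow {F : Type*} [NormedAddCommGroup F]
    [NormedSpace ℝ F] [Nontrivial F] [FiniteDimensional ℝ F] [MeasurableSpace F] [BorelSpace F]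
    (ν : Measure F) [ν.IsAddHaarMeasure] {s p : ℝ} (hs : -1 < s) (hp : 0 < p) :
    Integrable (fun w : F => ‖w‖ ^ s * Real.exp (-‖w‖ ^ p)) ν := by
  rw [integrable_fun_norm_addHaar ν (f := fun r => r ^ s * Real.exp (-r ^ p))]
  have hs' : -1 < s + ((Module.finrank ℝ F - 1 : ℕ) : ℝ) :=
    hs.trans_le (le_add_of_nonneg_right (Nat.cast_nonneg _))
  refine (integrableOn_rpow_mul_exp_neg_rpow hs' hp).congr_fun (fun r hr => ?_) measurableSet_Ioi
  have hr : 0 < r := hr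
  simp only [smul_eq_mul]
  rw [rpow_add hr, rpow_natCast]
  ring

/-- `lim_{N→∞} ∫ (√N/|W|) ∏_j g(w_j) dW = μ^{-1/2}` for the normalized density
`g(w) = e^{-|w|^{2+α}}/c` with `μ = ∫ |w|² g(w) dw`. -/
theorem lln_inverse_norm_limit (d : ℕ) (hd : 1 ≤ d) (α : ℝ) (hα : 0 < α)
    (c : ℝ) (hc : c = ∫ w : EuclideanSpace ℝ (Fin d), Real.exp (-‖w‖ ^ (2 + α)))
    (g : EuclideanSpace ℝ (Fin d) → ℝ)
    (hg : ∀ w, g w = Real.exp (-‖w‖ ^ (2 + α)) / c)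
    (μ : ℝ) (hμ : μ = ∫ w : EuclideanSpace ℝ (Fin d), ‖w‖ ^ 2 * g w) :
    Tendsto (fun N : ℕ =>
        ∫ W : Fin N → EuclideanSpace ℝ (Fin d),
          (Real.sqrt N / Real.sqrt (∑ j, ‖W j‖ ^ 2)) * ∏ j, g (W j))
      atTop (nhds (1 / Real.sqrt μ)) := by
  have : Nonempty (Fin d) := ⟨⟨0, hd⟩⟩
  have hp : 0 < 2 + α := by linarith
  have hmom : ∀ s : ℝ, -1 < s → Integrable fun w : EuclideanSpace ℝ (Fin d) => ‖w‖ ^ s * g w := by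
    intro s hs
    refine ((integrable_norm_rpow_mul_exp_neg_norm_rpow volume hs hp).div_const c).congr
      (ae_of_all _ fun w => ?_)
    simp only [hg, mul_div_assoc]
  have hexp : Integrable fun w : EuclideanSpace ℝ (Fin d) => Real.exp (-‖w‖ ^ (2 + α)) := by
    simpa using integrable_norm_rpow_mul_exp_neg_norm_rpow
      (volume : Measure (EuclideanSpace ℝ (Fin d))) (s := 0) (by norm_num) hp
  have hc0 : 0 < c := hc ▸ integral_exp_pos hexp
  have hg0 : ∀ w, 0 ≤ g w := fun w => by rw [hg]; positivity
  have hgi : Integrable g := by simpa using hmom 0 (by norm_num)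
  have hgm : Measurable g := by
    rw [funext hg]
    fun_prop
  have hg1 : ∫ w, g w = 1 := by
    simp only [hg]
    rw [integral_div, ← hc, div_self hc0.ne']
  set ν := (volume : Measure (EuclideanSpace ℝ (Fin d))).withDensity
    fun w => ENNReal.ofReal (g w) with hν
  have : IsProbabilityMeasure ν := by
    refine ⟨?_⟩
    rw [hν, withDensity_apply _ MeasurableSet.univ, Measure.restrict_univ,
      ← ofReal_integral_eq_lintegral_ofReal hgi (ae_of_all _ hg0), hg1, ENNReal.ofReal_one]
  have hνi : ∀ h : EuclideanSpace ℝ (Fin d) → ℝ, Integrable (fun w => h w * g w) →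
      Integrable h ν := by
    intro h hh
    rw [hν, integrable_withDensity_iff (by fun_prop) (ae_of_all _ fun _ => ENNReal.ofReal_lt_top)]
    simpa only [ENNReal.toReal_ofReal (hg0 _)] using hh
  have hsq : Measurable fun w : EuclideanSpace ℝ (Fin d) => ‖w‖ ^ 2 := by fun_prop
  have hμν : μ = ∫ w, ‖w‖ ^ 2 ∂ν := by
    rw [hμ, hν, integral_withDensity_eq_integral_toReal_smul (by fun_prop)
      (ae_of_all _ fun _ => ENNReal.ofReal_lt_top)]
    simp only [ENNReal.toReal_ofReal (hg0 _), smul_eq_mul, mul_comm]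
  have hpos : ∀ᵐ w ∂ν, 0 < ‖w‖ ^ 2 := by
    refine (withDensity_absolutelyContinuous _ _).ae_le ?_
    filter_upwards [Measure.ae_ne volume (0 : EuclideanSpace ℝ (Fin d))] with w hw
    have := norm_pos_iff.2 hw
    positivity
  have hf2 : MemLp (fun w : EuclideanSpace ℝ (Fin d) => ‖w‖ ^ 2) 2 ν := by
    rw [memLp_two_iff_integrable_sq hsq.aestronglyMeasurable]
    refine hνi _ ((hmom 4 (by norm_num)).congr (ae_of_all _ fun w => ?_))
    simp only [← pow_mul]
    norm_cast
  have hneg : Integrable (fun w : EuclideanSpace ℝ (Fin d) => (‖w‖ ^ 2) ^ (-((4 : ℕ) : ℝ)⁻¹)) ν := by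
    refine hνi _ ((hmom (-(1 / 2)) (by norm_num)).congr (ae_of_all _ fun w => ?_))
    simp only [← rpow_natCast ‖w‖ 2, ← rpow_mul (norm_nonneg w)]
    norm_num
  rw [hμν]
  refine (tendsto_integral_sqrt_div_sqrt_sum hsq hpos hf2 (by norm_num) hneg).congr fun N => ?_
  rw [hν, Measure.pi_withDensity_ofReal volume hgi hg0,
    integral_withDensity_eq_integral_toReal_smul (by fun_prop)
      (ae_of_all _ fun _ => ENNReal.ofReal_lt_top)]
  simp only [ENNReal.toReal_ofReal (Finset.prod_nonneg fun _ _ => hg0 _), smul_eq_mul, mul_comm]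
  rfl
end

section
/- (Pointwise limit of H_N) With the hypotheses and notation of the previous statement, for each fixed Y_k ∈ ℝ^{dk}, lim_{N→∞} H_N(Y_k) = φ(Y_k/√μ), where μ = ∫_{ℝ^d} |w|² g(w) dw. -/
open Real MeasureTheory Filter

/-- A sequence of functions on a probability space that converges almost everywhere to a constant
and is eventually bounded in `L²` has convergent integrals. -/
theorem tendsto_integral_of_ae_tendsto_of_integral_sq_le {Ω : Type*} [MeasurableSpace Ω]
    {P : Measure Ω} [IsProbabilityMeasure P] {f : ℕ → Ω → ℝ} {y C : ℝ}
    (hf : ∀ n, AEStronglyMeasurable (f n) P)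
    (hsq : ∀ᶠ n in atTop, Integrable (fun ω => f n ω ^ 2) P ∧ ∫ ω, f n ω ^ 2 ∂P ≤ C)
    (hlim : ∀ᵐ ω ∂P, Tendsto (fun n => f n ω) atTop (nhds y)) :
    Tendsto (fun n => ∫ ω, f n ω ∂P) atTop (nhds y) := by
  rw [Metric.tendsto_atTop']
  intro ε hε
  set M : ℝ := |y| + 1 + 2 * |C| / ε with hM
  have hquot : 0 ≤ 2 * |C| / ε := by positivity
  have hMpos : 0 < M := by positivity
  have hCM : C / M < ε / 2 + ε / 4 := by
    rw [div_lt_iff₀ hMpos, hM]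
    have : ε * (2 * |C| / ε) = 2 * |C| := by field_simp
    nlinarith [le_abs_self C, abs_nonneg C, abs_nonneg y]
  let T : ℝ → ℝ := fun x => max (-M) (min M x)
  have hTc : Continuous T := by fun_prop
  have hTy : T y = y := by
    have h1 := neg_abs_le y
    have h2 := le_abs_self y
    simp only [T]
    rw [min_eq_right (by linarith), max_eq_right (by linarith)]
  have hTb : ∀ x, |T x| ≤ M := fun x => by
    rw [abs_le]
    exact ⟨le_max_left _ _, max_le (by linarith) (min_le_left _ _)⟩
  have hTd : ∀ x, |x - T x| ≤ x ^ 2 / M := fun x => by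
    rw [le_div_iff₀ hMpos]
    simp only [T]
    rcases le_total M x with h | h
    · rw [min_eq_left h, max_eq_right (by linarith), abs_of_nonneg (by linarith)]
      nlinarith
    · rw [min_eq_right h]
      rcases le_total (-M) x with h' | h'
      · rw [max_eq_right h']; simp; positivity
      · rw [max_eq_left h', abs_of_nonpos (by linarith)]
        nlinarith
  have hTlim : Tendsto (fun n => ∫ ω, T (f n ω) ∂P) atTop (nhds y) := by
    have := tendsto_integral_of_dominated_convergence (μ := P) (F := fun n ω => T (f n ω))
      (f := fun _ => y) (fun _ => M) (fun n => hTc.comp_aestronglyMeasurable (hf n))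
      (integrable_const M) (fun n => ae_of_all _ fun ω => hTb _)
      (by
        filter_upwards [hlim] with ω hω
        have hcomp := (hTc.tendsto y).comp hω
        rwa [hTy] at hcomp)
    simpa using this
  have hev := (Metric.tendsto_nhds.1 hTlim (ε / 4) (by positivity)).and hsq
  obtain ⟨n₀, hn₀⟩ := eventually_atTop.1 hev
  refine ⟨n₀, fun n hn => ?_⟩
  obtain ⟨hclose, hint, hbound⟩ := hn₀ n hn.le
  have hfint : Integrable (f n) P :=
    ((memLp_two_iff_integrable_sq (hf n)).2 hint).integrable (by norm_num)
  have hTint : Integrable (fun ω => T (f n ω)) P :=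
    (integrable_const M).mono' (hTc.comp_aestronglyMeasurable (hf n)) (ae_of_all _ fun ω => hTb _)
  have hdiff : |∫ ω, f n ω ∂P - ∫ ω, T (f n ω) ∂P| ≤ C / M := by
    rw [← integral_sub hfint hTint]
    calc |∫ ω, (f n ω - T (f n ω)) ∂P| ≤ ∫ ω, |f n ω - T (f n ω)| ∂P :=
          abs_integral_le_integral_abs
      _ ≤ ∫ ω, f n ω ^ 2 / M ∂P :=
          integral_mono (hfint.sub hTint).abs (hint.div_const M) fun ω => hTd _
      _ = (∫ ω, f n ω ^ 2 ∂P) / M := integral_div _ _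
      _ ≤ C / M := by gcongr
  rw [Real.dist_eq] at hclose ⊢
  have := abs_sub_le (∫ ω, f n ω ∂P) (∫ ω, T (f n ω) ∂P) y
  linarith

/-- The arithmetic-geometric mean inequality bounds an inverse mean of squares by a product. -/
theorem div_sum_sq_le_prod {n : ℕ} (hn : 4 ≤ n) {r : Fin n → ℝ} (hr : ∀ i, 0 < r i) :
    (n : ℝ) / ∑ i, r i ^ 2 ≤ ∏ i, (1 + 4 / (n : ℝ) * r i ^ (-(1 / 2) : ℝ)) := by
  have hn0 : (0 : ℝ) < n := by exact_mod_cast (by omega : 0 < n)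
  have hn4 : (4 : ℝ) ≤ n := by exact_mod_cast hn
  have hamgm : ∏ i, (r i ^ 2) ^ ((n : ℝ)⁻¹) ≤ ∑ i, (n : ℝ)⁻¹ * r i ^ 2 :=
    Real.geom_mean_le_arith_mean_weighted _ _ _ (fun _ _ => by positivity)
      (by simp [hn0.ne']) (fun _ _ => by positivity)
  have hpos : 0 < ∏ i, (r i ^ 2) ^ ((n : ℝ)⁻¹) :=
    Finset.prod_pos fun i _ => Real.rpow_pos_of_pos (pow_pos (hr i) 2) _
  have heq : (n : ℝ) / ∑ i, r i ^ 2 = (∑ i, (n : ℝ)⁻¹ * r i ^ 2)⁻¹ := by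
    rw [← Finset.mul_sum, mul_inv, inv_inv, div_eq_mul_inv]
  rw [heq]
  refine (inv_anti₀ hpos hamgm).trans ?_
  rw [← Finset.prod_inv_distrib]
  refine Finset.prod_le_prod (fun i _ => by have := hr i; positivity) fun i _ => ?_
  have hy : 0 < r i ^ (-(1 / 2) : ℝ) := Real.rpow_pos_of_pos (hr i) _
  have hrew : ((r i ^ 2) ^ ((n : ℝ)⁻¹))⁻¹ =
      (1 + (r i ^ (-(1 / 2) : ℝ) - 1)) ^ (4 / (n : ℝ)) := by
    rw [add_sub_cancel, ← Real.rpow_natCast, ← Real.rpow_mul (hr i).le, ← Real.rpow_neg (hr i).le,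
      ← Real.rpow_mul (hr i).le]
    congr 1
    push_cast
    ring
  rw [hrew]
  refine (rpow_one_add_le_one_add_mul_self (by linarith) (by positivity)
    ((div_le_one hn0).2 hn4)).trans ?_
  have : 0 < 4 / (n : ℝ) := by positivity
  nlinarith

theorem ae_pi_norm_pos {E : Type*} [NormedAddCommGroup E] [MeasurableSpace E]
    {ν : Measure E} [IsProbabilityMeasure ν] (h0 : ν {0} = 0) (n : ℕ) :
    ∀ᵐ W ∂(Measure.pi fun _ : Fin n => ν), ∀ i, 0 < ‖W i‖ := by
  have hν : ∀ᵐ w ∂ν, 0 < ‖w‖ := by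
    simp only [norm_pos_iff]
    exact measure_eq_zero_iff_ae_notMem.1 h0
  exact ae_all_iff.2 fun i =>
    (measurePreserving_eval (fun _ : Fin n => ν) i).quasiMeasurePreserving.ae hν

section Product

variable {E : Type*} [NormedAddCommGroup E] [MeasurableSpace E] [BorelSpace E]
  [SecondCountableTopology E]

/-- A product measure with sufficiently many factors gives the inverse mean of the squared norms a
uniformly bounded expectation, as soon as one factor has a negative moment. -/
theorem integrable_div_sum_sq_norm {ν : Measure E} [IsProbabilityMeasure ν] (h0 : ν {0} = 0)
    (hneg : Integrable (fun w : E => ‖w‖ ^ (-(1 / 2) : ℝ)) ν) {n : ℕ} (hn : 4 ≤ n) :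
    Integrable (fun W : Fin n → E => (n : ℝ) / ∑ i, ‖W i‖ ^ 2) (Measure.pi fun _ => ν) ∧
      ∫ W : Fin n → E, (n : ℝ) / ∑ i, ‖W i‖ ^ 2 ∂(Measure.pi fun _ => ν) ≤
        Real.exp (4 * ∫ w, ‖w‖ ^ (-(1 / 2) : ℝ) ∂ν) := by
  have hn0 : (0 : ℝ) < n := by exact_mod_cast (by omega : 0 < n)
  have hfac : Integrable (fun w : E => 1 + 4 / (n : ℝ) * ‖w‖ ^ (-(1 / 2) : ℝ)) ν :=
    (integrable_const 1).add (hneg.const_mul _)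
  have hprod : Integrable (fun W : Fin n → E => ∏ i, (1 + 4 / (n : ℝ) * ‖W i‖ ^ (-(1 / 2) : ℝ)))
      (Measure.pi fun _ => ν) := Integrable.fintype_prod fun _ => hfac
  have hle : (fun W : Fin n → E => (n : ℝ) / ∑ i, ‖W i‖ ^ 2) ≤ᵐ[Measure.pi fun _ => ν]
      fun W => ∏ i, (1 + 4 / (n : ℝ) * ‖W i‖ ^ (-(1 / 2) : ℝ)) := by
    filter_upwards [ae_pi_norm_pos h0 n] with W hW using div_sum_sq_le_prod hn hW
  have hint : Integrable (fun W : Fin n → E => (n : ℝ) / ∑ i, ‖W i‖ ^ 2)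
      (Measure.pi fun _ => ν) := by
    refine hprod.mono' (Measurable.aestronglyMeasurable (by fun_prop)) ?_
    filter_upwards [hle] with W hW
    rwa [Real.norm_of_nonneg (by positivity)]
  refine ⟨hint, (integral_mono_ae hint hprod hle).trans ?_⟩
  rw [integral_fintype_prod_eq_pow (𝕜 := ℝ) fun w : E => 1 + 4 / (n : ℝ) * ‖w‖ ^ (-(1 / 2) : ℝ),
    integral_add (integrable_const 1) (hneg.const_mul _), integral_const_mul]
  have hI : 0 ≤ ∫ w, ‖w‖ ^ (-(1 / 2) : ℝ) ∂ν := integral_nonneg fun w => by positivity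
  set I := ∫ w, ‖w‖ ^ (-(1 / 2) : ℝ) ∂ν
  calc _ = (4 / (n : ℝ) * I + 1) ^ n := by simp [add_comm]
    _ ≤ Real.exp (4 / (n : ℝ) * I) ^ n := by
      gcongr
      exact Real.add_one_le_exp _
    _ = Real.exp (4 * I) := by
      rw [← Real.exp_nat_mul]
      congr 1
      field_simp

/-- Expectations of bounded continuous functions of the self-normalizing factor
`√(n + m) / √(a + ∑ ‖W i‖²)`, weighted by that factor, converge to the value predicted by the law of
large numbers. -/
theorem tendsto_integral_pi_self_normalized {ν : Measure E} [IsProbabilityMeasure ν]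
    (h0 : ν {0} = 0) (hneg : Integrable (fun w : E => ‖w‖ ^ (-(1 / 2) : ℝ)) ν)
    (hsq : Integrable (fun w : E => ‖w‖ ^ 2) ν) (hpos : 0 < ∫ w, ‖w‖ ^ 2 ∂ν)
    {F : ℝ → ℝ} (hF : Continuous F) {K : ℝ} (hK : ∀ r, |F r| ≤ K) {a : ℝ} (ha : 0 ≤ a) (m : ℕ) :
    Tendsto (fun n : ℕ => ∫ W : Fin n → E,
        F (√((n + m : ℕ) : ℝ) / √(a + ∑ i, ‖W i‖ ^ 2)) *
          (√((n + m : ℕ) : ℝ) / √(a + ∑ i, ‖W i‖ ^ 2)) ∂(Measure.pi fun _ => ν)) atTop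
      (nhds (F (√(∫ w, ‖w‖ ^ 2 ∂ν))⁻¹ * (√(∫ w, ‖w‖ ^ 2 ∂ν))⁻¹)) := by
  set μ := ∫ w, ‖w‖ ^ 2 ∂ν with hμ
  let P : Measure (ℕ → E) := Measure.infinitePi fun _ => ν
  let G : (n : ℕ) → (Fin n → E) → ℝ := fun n W =>
    √((n + m : ℕ) : ℝ) / √(a + ∑ i, ‖W i‖ ^ 2)
  have hGm : ∀ n, Measurable (G n) := fun n => by fun_prop
  let R : (n : ℕ) → (ℕ → E) → Fin n → E := fun n ω i => ω i
  have hR : ∀ n, MeasurePreserving (R n) P (Measure.pi fun _ => ν) := fun n => by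
    refine ⟨by fun_prop, ?_⟩
    rw [← Measure.infinitePi_eq_pi]
    exact Measure.map_infinitePi_infinitePi_of_inj (P := fun _ : ℕ => ν) Fin.val_injective
  have hFG : ∀ n, Measurable fun W => F (G n W) * G n W := fun n =>
    (hF.measurable.comp (hGm n)).mul (hGm n)
  have htransfer : ∀ n, ∫ W, F (G n W) * G n W ∂(Measure.pi fun _ => ν) =
      ∫ ω, F (G n (R n ω)) * G n (R n ω) ∂P := fun n => by
    rw [← (hR n).map_eq, integral_map (hR n).measurable.aemeasurable
      (hFG n).aestronglyMeasurable]
  change Tendsto (fun n => ∫ W, F (G n W) * G n W ∂(Measure.pi fun _ => ν)) _ _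
  simp_rw [htransfer]
  refine tendsto_integral_of_ae_tendsto_of_integral_sq_le
    (C := K ^ 2 * ((m + 1) * Real.exp (4 * ∫ w, ‖w‖ ^ (-(1 / 2) : ℝ) ∂ν)))
    (fun n => ((hFG n).comp (hR n).measurable).aestronglyMeasurable) ?_ ?_
  · filter_upwards [eventually_ge_atTop 4] with n hn
    obtain ⟨hint, hbound⟩ := integrable_div_sum_sq_norm h0 hneg hn
    have hle : (fun W => (F (G n W) * G n W) ^ 2) ≤ᵐ[Measure.pi fun _ => ν]
        fun W => K ^ 2 * ((m + 1) * ((n : ℝ) / ∑ i, ‖W i‖ ^ 2)) := by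
      filter_upwards [ae_pi_norm_pos h0 n] with W hW
      have hS : 0 < ∑ i, ‖W i‖ ^ 2 := by
        have : Nonempty (Fin n) := ⟨⟨0, by omega⟩⟩
        exact Finset.sum_pos (fun i _ => pow_pos (hW i) 2) Finset.univ_nonempty
      rw [mul_pow]
      have hF2 : F (G n W) ^ 2 ≤ K ^ 2 := sq_le_sq' (by linarith [abs_le.1 (hK (G n W))])
        (abs_le.1 (hK _)).2
      have hG2 : G n W ^ 2 ≤ (m + 1) * ((n : ℝ) / ∑ i, ‖W i‖ ^ 2) := by
        simp only [G]
        rw [div_pow, Real.sq_sqrt (by positivity), Real.sq_sqrt (by positivity), mul_div_assoc']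
        have hn1 : (1 : ℝ) ≤ n := by exact_mod_cast (by omega : 1 ≤ n)
        apply div_le_div₀ (by positivity) _ hS (by linarith)
        push_cast
        nlinarith [(Nat.cast_nonneg m : (0 : ℝ) ≤ m)]
      gcongr
    have hint' := (hint.const_mul ((m : ℝ) + 1)).const_mul (K ^ 2)
    have hsqint : Integrable (fun W => (F (G n W) * G n W) ^ 2) (Measure.pi fun _ => ν) := by
      refine hint'.mono' ((hFG n).pow_const 2).aestronglyMeasurable ?_
      filter_upwards [hle] with W hW
      rwa [Real.norm_of_nonneg (by positivity)]
    refine ⟨(hR n).integrable_comp_of_integrable hsqint, ?_⟩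
    have hmap : ∫ ω, (F (G n (R n ω)) * G n (R n ω)) ^ 2 ∂P =
        ∫ W, (F (G n W) * G n W) ^ 2 ∂(Measure.pi fun _ => ν) := by
      rw [← (hR n).map_eq, integral_map (hR n).measurable.aemeasurable
        ((hFG n).pow_const 2).aestronglyMeasurable]
    rw [hmap]
    refine (integral_mono_ae hsqint hint' hle).trans ?_
    rw [integral_const_mul, integral_const_mul]
    gcongr
  · have hlaw : ∀ᵐ ω ∂P, Tendsto
        (fun n : ℕ => (∑ i ∈ Finset.range n, ‖ω i‖ ^ 2) / n) atTop (nhds μ) := by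
      have hmap : ∀ i, P.map (fun ω => ω i) = ν := fun i =>
        Measure.infinitePi_map_eval (fun _ : ℕ => ν) i
      have hmeas : Measurable fun w : E => ‖w‖ ^ 2 := by fun_prop
      have hev : ∀ i : ℕ, MeasurePreserving (fun ω : ℕ → E => ω i) P ν :=
        fun i => measurePreserving_eval_infinitePi (fun _ : ℕ => ν) i
      have := ProbabilityTheory.strong_law_ae_real (μ := P)
        (fun i ω => ‖ω i‖ ^ 2) ((hev 0).integrable_comp_of_integrable hsq)
        (fun i j hij => (ProbabilityTheory.iIndepFun_infinitePi (P := fun _ : ℕ => ν)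
          (X := fun _ w => ‖w‖ ^ 2) (fun _ => hmeas)).indepFun hij)
        (fun i => ProbabilityTheory.IdentDistrib.comp
          (f := fun ω : ℕ → E => ω i) (g := fun ω : ℕ → E => ω 0)
          ⟨(hev i).measurable.aemeasurable, (hev 0).measurable.aemeasurable, by rw [hmap, hmap]⟩ hmeas)
      have hmean : ∫ ω, ‖ω 0‖ ^ 2 ∂P = μ := by
        rw [hμ, ← hmap 0, integral_map (hev 0).measurable.aemeasurable (by fun_prop)]
      rwa [hmean] at this
    filter_upwards [hlaw] with ω hω
    have hratio : Tendsto (fun n : ℕ => ((n + m : ℕ) : ℝ) / n) atTop (nhds 1) := by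
      have h1 : Tendsto (fun n : ℕ => 1 + (m : ℝ) / n) atTop (nhds (1 + 0)) :=
        tendsto_const_nhds.add (tendsto_const_div_atTop_nhds_zero_nat _)
      rw [add_zero] at h1
      refine h1.congr' ?_
      filter_upwards [eventually_gt_atTop 0] with n hn
      have : (n : ℝ) ≠ 0 := by exact_mod_cast hn.ne'
      push_cast
      field_simp
    have hden : Tendsto (fun n : ℕ => a / n + (∑ i ∈ Finset.range n, ‖ω i‖ ^ 2) / n) atTop
        (nhds (0 + μ)) := (tendsto_const_div_atTop_nhds_zero_nat a).add hω
    rw [zero_add] at hden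
    have hG : Tendsto (fun n => G n (R n ω)) atTop (nhds (√μ)⁻¹) := by
      have := (hratio.div hden hpos.ne').sqrt
      rw [one_div, Real.sqrt_inv] at this
      refine this.congr' ?_
      filter_upwards [eventually_gt_atTop 0] with n hn
      have hn' : (n : ℝ) ≠ 0 := by exact_mod_cast hn.ne'
      simp only [G, R, Pi.div_apply]
      rw [← Real.sqrt_div (by positivity), Fin.sum_univ_eq_sum_range fun i => ‖ω i‖ ^ 2]
      congr 1
      field_simp
    exact ((hF.tendsto _).comp hG).mul hG

end Product

/-- The integral of a function against a product density is the integral against the product of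
the measures with that density. -/
theorem integral_mul_prod_density {ι E : Type*} [Fintype ι] [MeasureSpace E]
    [SigmaFinite (volume : Measure E)] {g : E → ℝ} (hgm : Measurable g) (hg0 : ∀ w, 0 ≤ g w)
    (hgi : Integrable g) (f : (ι → E) → ℝ) :
    ∫ W, f W * ∏ i, g (W i) =
      ∫ W, f W ∂(Measure.pi fun _ : ι => volume.withDensity fun w => ENNReal.ofReal (g w)) := by
  have : IsFiniteMeasure (volume.withDensity fun w => ENNReal.ofReal (g w)) :=
    isFiniteMeasure_withDensity_ofReal hgi.2
  have hpi : (Measure.pi fun _ : ι => volume.withDensity fun w => ENNReal.ofReal (g w)) =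
      (volume : Measure (ι → E)).withDensity fun W => ENNReal.ofReal (∏ i, g (W i)) := by
    refine Measure.pi_eq fun s hs => ?_
    have hbox : MeasurableSet (Set.univ.pi s) := MeasurableSet.univ_pi hs
    rw [withDensity_apply _ hbox, volume_pi, Measure.restrict_pi_pi,
      ← ofReal_integral_eq_lintegral_ofReal
        (Integrable.fintype_prod (f := fun _ => g) fun i => hgi.restrict)
        (ae_of_all _ fun W => Finset.prod_nonneg fun i _ => hg0 _),
      integral_fintype_prod_eq_prod (𝕜 := ℝ) (fun _ => g),
      ENNReal.ofReal_prod_of_nonneg fun i _ => integral_nonneg fun w => hg0 w]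
    refine Finset.prod_congr rfl fun i _ => ?_
    rw [withDensity_apply _ (hs i), ofReal_integral_eq_lintegral_ofReal hgi.restrict
      (ae_of_all _ hg0)]
  rw [hpi, integral_withDensity_eq_integral_toReal_smul (by fun_prop)
    (ae_of_all _ fun _ => ENNReal.ofReal_lt_top)]
  refine integral_congr_ae (ae_of_all _ fun W => ?_)
  simp only [smul_eq_mul]
  rw [ENNReal.toReal_ofReal (Finset.prod_nonneg fun i _ => hg0 _), mul_comm]

theorem integrable_norm_rpow_mul_exp_neg {E : Type*} [NormedAddCommGroup E] [NormedSpace ℝ E]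
    [FiniteDimensional ℝ E] [Nontrivial E] [MeasurableSpace E] [BorelSpace E]
    (ν : Measure E) [ν.IsAddHaarMeasure] {s p : ℝ} (hs : -1 < s) (hp : 0 < p) :
    Integrable (fun w : E => ‖w‖ ^ s * Real.exp (-‖w‖ ^ p)) ν := by
  rw [integrable_fun_norm_addHaar ν (f := fun r => r ^ s * Real.exp (-r ^ p))]
  have hdim : 1 ≤ Module.finrank ℝ E := Module.finrank_pos
  refine (integrableOn_rpow_mul_exp_neg_rpow (p := p)
    (s := s + (Module.finrank ℝ E - 1 : ℕ)) ?_ hp).congr_fun (fun r hr => ?_) measurableSet_Ioi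
  · have : (0 : ℝ) ≤ (Module.finrank ℝ E - 1 : ℕ) := Nat.cast_nonneg _
    linarith
  · simp only [smul_eq_mul]
    rw [Real.rpow_add_natCast (ne_of_gt hr)]
    ring

/-- Pointwise limit of `H_N`: for each fixed `Y_k`,
`lim_{N→∞} H_N(Y_k) = φ(Y_k/√μ)` where `μ = ∫ |w|² g(w) dw`. -/
theorem H_N_pointwise_limit (d k : ℕ) (hd : 1 ≤ d) (hk : 1 ≤ k) (α : ℝ) (hα : 0 < α)
    (c : ℝ) (hc : c = ∫ w : EuclideanSpace ℝ (Fin d), Real.exp (-‖w‖ ^ (2 + α)))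
    (g : EuclideanSpace ℝ (Fin d) → ℝ)
    (hg : ∀ w, g w = Real.exp (-‖w‖ ^ (2 + α)) / c)
    (μ : ℝ) (hμ : μ = ∫ w : EuclideanSpace ℝ (Fin d), ‖w‖ ^ 2 * g w)
    (φ : (Fin k → EuclideanSpace ℝ (Fin d)) → ℝ) (hφc : Continuous φ)
    (K : ℝ) (hφK : ∀ x, |φ x| ≤ K)
    (Z : ℕ → ℝ)
    (hZ : ∀ N : ℕ, Z N = ((2 + α) / Real.Gamma (((d * N : ℝ) - 1) / (2 + α))) *
      ∫ W : Fin N → EuclideanSpace ℝ (Fin d),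
        (∏ i, g (W i)) / Real.sqrt (∑ i, ‖W i‖ ^ 2))
    (H : (N : ℕ) → (Fin k → EuclideanSpace ℝ (Fin d)) → ℝ)
    (hH : ∀ N : ℕ, k < N → ∀ Yk : Fin k → EuclideanSpace ℝ (Fin d),
      H N Yk = ((2 + α) / (Real.Gamma (((d * N : ℝ) - 1) / (2 + α)) * Z N * Real.sqrt N)) *
        ∫ Y' : Fin (N - k) → EuclideanSpace ℝ (Fin d),
          φ (fun i => (Real.sqrt N /
              Real.sqrt ((∑ i, ‖Yk i‖ ^ 2) + ∑ j, ‖Y' j‖ ^ 2)) • Yk i) *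
            (Real.sqrt N / Real.sqrt ((∑ i, ‖Yk i‖ ^ 2) + ∑ j, ‖Y' j‖ ^ 2)) *
            ∏ j, g (Y' j))
    (Yk : Fin k → EuclideanSpace ℝ (Fin d)) :
    Tendsto (fun N : ℕ => H N Yk) atTop
      (nhds (φ (fun i => (Real.sqrt μ)⁻¹ • Yk i))) := by
  have hnt : Nontrivial (EuclideanSpace ℝ (Fin d)) := by
    have : Nonempty (Fin d) := ⟨⟨0, hd⟩⟩
    infer_instance
  have hp : 0 < 2 + α := by linarith
  have hexp : Integrable fun w : EuclideanSpace ℝ (Fin d) => Real.exp (-‖w‖ ^ (2 + α)) := by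
    simpa using integrable_norm_rpow_mul_exp_neg (E := EuclideanSpace ℝ (Fin d)) volume
      (s := 0) (by norm_num) hp
  have hcpos : 0 < c := hc ▸ integral_exp_pos hexp
  obtain rfl : g = fun w => Real.exp (-‖w‖ ^ (2 + α)) / c := funext hg
  set g : EuclideanSpace ℝ (Fin d) → ℝ := fun w => Real.exp (-‖w‖ ^ (2 + α)) / c with hgdef
  have hgm : Measurable g := by fun_prop
  have hg0 : ∀ w, 0 ≤ g w := fun w => by positivity
  have hgi : Integrable g := hexp.div_const c
  have hmoment : ∀ s : ℝ, -1 < s → Integrable fun w => ‖w‖ ^ s * g w := fun s hs => by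
    simpa only [hgdef, mul_div_assoc] using
      (integrable_norm_rpow_mul_exp_neg (E := EuclideanSpace ℝ (Fin d)) volume hs hp).div_const c
  let ν : Measure (EuclideanSpace ℝ (Fin d)) := volume.withDensity fun w => ENNReal.ofReal (g w)
  have hνp : IsProbabilityMeasure ν := by
    refine ⟨?_⟩
    rw [withDensity_apply _ MeasurableSet.univ, Measure.restrict_univ,
      ← ofReal_integral_eq_lintegral_ofReal hgi (ae_of_all _ hg0), hgdef, integral_div, ← hc,
      div_self hcpos.ne', ENNReal.ofReal_one]
  have hν0 : ν {0} = 0 := withDensity_absolutelyContinuous _ _ (measure_singleton 0)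
  have hν : ∀ f : EuclideanSpace ℝ (Fin d) → ℝ, Integrable (fun w => f w * g w) →
      Integrable f ν := fun f hf => by
    rw [integrable_withDensity_iff (by fun_prop) (ae_of_all _ fun _ => ENNReal.ofReal_lt_top)]
    simpa only [ENNReal.toReal_ofReal (hg0 _)] using hf
  have hneg : Integrable (fun w => ‖w‖ ^ (-(1 / 2) : ℝ)) ν := hν _ (hmoment _ (by norm_num))
  have hsq : Integrable (fun w => ‖w‖ ^ 2) ν := hν _ (by
    simpa only [Real.rpow_two] using hmoment 2 (by norm_num))
  have hμν : μ = ∫ w, ‖w‖ ^ 2 ∂ν := by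
    rw [hμ, integral_withDensity_eq_integral_toReal_smul (by fun_prop)
      (ae_of_all _ fun _ => ENNReal.ofReal_lt_top)]
    simp only [ENNReal.toReal_ofReal (hg0 _), smul_eq_mul, mul_comm]
  have hμpos : 0 < ∫ w, ‖w‖ ^ 2 ∂ν := by
    refine (integral_nonneg fun w => by positivity).lt_of_ne fun h => ?_
    have hzero := (integral_eq_zero_iff_of_nonneg (fun w => by positivity) hsq).1 h.symm
    have hne : ∀ᵐ w ∂ν, w ∉ ({0} : Set (EuclideanSpace ℝ (Fin d))) :=
      measure_eq_zero_iff_ae_notMem.1 hν0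
    obtain ⟨w, hw, hw'⟩ := (hzero.and hne).exists
    exact hw' (norm_eq_zero.1 (pow_eq_zero_iff two_ne_zero |>.1 hw))
  have hsqrt : (√μ)⁻¹ ≠ 0 := inv_ne_zero (Real.sqrt_pos.2 (hμν ▸ hμpos)).ne'
  let J : ℕ → ℝ := fun N =>
    ∫ W : Fin N → EuclideanSpace ℝ (Fin d), (∏ i, g (W i)) / √(∑ i, ‖W i‖ ^ 2)
  have hJ : Tendsto (fun N : ℕ => √(N : ℝ) * J N) atTop (nhds (√μ)⁻¹) := by
    have hlim := tendsto_integral_pi_self_normalized hν0 hneg hsq hμpos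
      (F := fun _ => 1) continuous_const (K := 1) (by simp) le_rfl 0
    rw [← hμν] at hlim
    simp only [one_mul, zero_add, add_zero] at hlim
    refine hlim.congr fun N => ?_
    rw [← integral_mul_prod_density hgm hg0 hgi, ← integral_const_mul]
    refine integral_congr_ae (ae_of_all _ fun W => ?_)
    ring
  let I : ℕ → ℝ := fun N => ∫ Y' : Fin (N - k) → EuclideanSpace ℝ (Fin d),
    φ (fun i => (√(N : ℝ) / √((∑ i, ‖Yk i‖ ^ 2) + ∑ j, ‖Y' j‖ ^ 2)) • Yk i) *
      (√(N : ℝ) / √((∑ i, ‖Yk i‖ ^ 2) + ∑ j, ‖Y' j‖ ^ 2)) * ∏ j, g (Y' j)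
  have hI : Tendsto I atTop (nhds (φ (fun i => (√μ)⁻¹ • Yk i) * (√μ)⁻¹)) := by
    have hlim := tendsto_integral_pi_self_normalized hν0 hneg hsq hμpos
      (F := fun r => φ fun i => r • Yk i) (by fun_prop) (fun r => hφK _)
      (a := ∑ i, ‖Yk i‖ ^ 2) (by positivity) k
    rw [← hμν] at hlim
    refine (tendsto_add_atTop_iff_nat k).1 (hlim.congr fun n => ?_)
    rw [← integral_mul_prod_density hgm hg0 hgi]
    simp only [I]
    rw [Nat.add_sub_cancel]
  have hratio := hI.div hJ hsqrt
  rw [mul_div_cancel_right₀ _ hsqrt] at hratio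
  refine hratio.congr' ?_
  filter_upwards [eventually_gt_atTop k] with N hN
  have hN2 : (2 : ℝ) ≤ N := by exact_mod_cast (by omega : 2 ≤ N)
  have hd1 : (1 : ℝ) ≤ d := by exact_mod_cast hd
  have hΓ : 0 < Real.Gamma (((d * N : ℝ) - 1) / (2 + α)) :=
    Real.Gamma_pos_of_pos (div_pos (by nlinarith) hp)
  rw [hH N hN Yk, hZ N]
  change I N / (√(N : ℝ) * J N) = (2 + α) / (_ * ((2 + α) / _ * J N) * √(N : ℝ)) * I N
  have hΓZ : ∀ Γ : ℝ, Γ ≠ 0 → Γ * ((2 + α) / Γ * J N) * √(N : ℝ) =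
      (2 + α) * (√(N : ℝ) * J N) := fun Γ h => by field_simp
  rw [hΓZ _ hΓ.ne', ← div_div (2 + α), div_self hp.ne', one_div, div_eq_inv_mul]
end
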